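/- arXiv:2402.08628 — 2 statements merged into one kernel-verified Lean document; each statement's English description precedes it below -/
import Mathlib

section
/- Let G be a graphon with ‖G(u,·)‖₁ > 0 for Lebesgue-a.e. u ∈ [0,1]. Then for any ν, η ∈ M(ℝ^d), the operator μ ↦ ([Gμ]^u)_{u∈[0,1]} is a contraction for the uniform Wasserstein distance: ess-sup_{u∈[0,1]} W₂([Gν]^u, [Gη]^u) ≤ ess-sup_{u∈[0,1]} W₂(ν^u, η^u). -/
open MeasureTheory ENNReal Set Filter

noncomputable section

/-- The state space `ℝ^d`. -/
abbrev Ed (d : ℕ) : Type := EuclideanSpace ℝ (Fin d)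

/-- The degree function `‖G(u,·)‖₁ = ∫₀¹ G(u,v) dv` of a graphon. -/
def deg (G : ℝ → ℝ → ℝ) (u : ℝ) : ℝ := ∫ v in Set.Icc (0:ℝ) 1, G u v

/-- A graphon: a symmetric measurable function `[0,1]² → [0,1]`
(represented as a total function on `ℝ²`). -/
structure IsGraphon (G : ℝ → ℝ → ℝ) : Prop where
  measurable : Measurable (Function.uncurry G)
  symm : ∀ u v, G u v = G v u
  mem_Icc : ∀ u ∈ Set.Icc (0:ℝ) 1, ∀ v ∈ Set.Icc (0:ℝ) 1, G u v ∈ Set.Icc (0:ℝ) 1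

/-- The class `M(ℝ^d)`: families `(μ^u)_{u∈[0,1]}` of probability measures with
setwise measurable dependence on `u` and uniformly bounded second moments. -/
structure MemM (d : ℕ) (μ : ℝ → Measure (Ed d)) : Prop where
  prob : ∀ u ∈ Set.Icc (0:ℝ) 1, IsProbabilityMeasure (μ u)
  meas : ∀ B : Set (Ed d), MeasurableSet B → Measurable fun u => μ u B
  moment : (⨆ u ∈ Set.Icc (0:ℝ) 1, ∫⁻ x, (‖x‖₊ : ℝ≥0∞) ^ 2 ∂(μ u)) < ⊤

/-- The graphon-averaged measure `[Gμ]^u = ‖G(u,·)‖₁⁻¹ ∫₀¹ G(u,v) μ^v dv`. -/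
def graphonAvg {d : ℕ} (G : ℝ → ℝ → ℝ) (μ : ℝ → Measure (Ed d)) (u : ℝ) :
    Measure (Ed d) :=
  Measure.bind
    ((volume.restrict (Set.Icc (0:ℝ) 1)).withDensity
      fun v => ENNReal.ofReal (G u v) / ENNReal.ofReal (deg G u)) μ


/-- Squared 2-Wasserstein distance (valued in `ℝ≥0∞`), as the infimum over couplings of the
integral of the squared distance. -/
def W2sq {E : Type} [MeasurableSpace E] [NormedAddCommGroup E] (μ ν : Measure E) : ℝ≥0∞ :=
  ⨅ (π : Measure (E × E)) (_ : π.map Prod.fst = μ ∧ π.map Prod.snd = ν),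
    ∫⁻ p, (‖p.1 - p.2‖₊ : ℝ≥0∞) ^ 2 ∂π

/-- 2-Wasserstein distance (valued in `ℝ≥0∞`). -/
def W2 {E : Type} [MeasurableSpace E] [NormedAddCommGroup E] (μ ν : Measure E) : ℝ≥0∞ :=
  W2sq μ ν ^ (1/2 : ℝ)

open scoped Topology
open ProbabilityTheory

section Averages

variable {X : Type*} [MeasurableSpace X]

/-- The average of the first `n + 1` terms of a sequence of measures. -/
def avgMeasure (p : ℕ → Measure X) (n : ℕ) : Measure X :=
  ((n + 1 : ℕ) : ℝ≥0∞)⁻¹ • ∑ i ∈ Finset.range (n + 1), p i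

lemma lintegral_avgMeasure (p : ℕ → Measure X) (n : ℕ) (f : X → ℝ≥0∞) :
    ∫⁻ x, f x ∂(avgMeasure p n) =
      ((n + 1 : ℕ) : ℝ≥0∞)⁻¹ * ∑ i ∈ Finset.range (n + 1), ∫⁻ x, f x ∂(p i) := by
  simp only [avgMeasure, lintegral_smul_measure, smul_eq_mul]
  rw [lintegral_finsetSum_measure]

lemma lintegral_avgMeasure_le {p : ℕ → Measure X} {f : X → ℝ≥0∞} {K : ℝ≥0∞}
    (h : ∀ i, ∫⁻ x, f x ∂(p i) ≤ K) (n : ℕ) : ∫⁻ x, f x ∂(avgMeasure p n) ≤ K := by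
  rw [lintegral_avgMeasure]
  calc ((n + 1 : ℕ) : ℝ≥0∞)⁻¹ * ∑ i ∈ Finset.range (n + 1), ∫⁻ x, f x ∂(p i)
      ≤ ((n + 1 : ℕ) : ℝ≥0∞)⁻¹ * ∑ i ∈ Finset.range (n + 1), K := by
        gcongr; exact h _
    _ = K := by
        rw [Finset.sum_const, Finset.card_range, nsmul_eq_mul, ← mul_assoc,
          ENNReal.inv_mul_cancel (by simp) (ENNReal.natCast_ne_top _), one_mul]

lemma isProbabilityMeasure_avgMeasure {p : ℕ → Measure X} (hp : ∀ i, IsProbabilityMeasure (p i))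
    (n : ℕ) : IsProbabilityMeasure (avgMeasure p n) := by
  constructor
  have := lintegral_avgMeasure p n 1
  simp only [Pi.one_apply, lintegral_one, measure_univ, Finset.sum_const, Finset.card_range,
    nsmul_eq_mul, mul_one] at this
  rw [this, ENNReal.inv_mul_cancel (by simp) (ENNReal.natCast_ne_top _)]

lemma map_avgMeasure {Y : Type*} [MeasurableSpace Y] (p : ℕ → Measure X) {f : X → Y}
    (hf : Measurable f) (n : ℕ) : (avgMeasure p n).map f = avgMeasure (fun i => (p i).map f) n := by
  rw [avgMeasure, Measure.map_smul, Measure.map_finset_sum hf.aemeasurable, avgMeasure]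

lemma charFun_avgMeasure {E : Type*} [NormedAddCommGroup E] [InnerProductSpace ℝ E]
    [MeasurableSpace E] [BorelSpace E] {p : ℕ → Measure E}
    (hp : ∀ i, IsProbabilityMeasure (p i)) (n : ℕ) (t : E) :
    charFun (avgMeasure p n) t =
      ((n + 1 : ℕ) : ℝ)⁻¹ • ∑ i ∈ Finset.range (n + 1), charFun (p i) t := by
  simp only [charFun_eq_integral_innerProbChar, avgMeasure, integral_smul_measure]
  rw [integral_finsetSum_measure]
  · rw [ENNReal.toReal_inv, ENNReal.toReal_natCast]
  · intro i _
    exact BoundedContinuousFunction.integrable _ _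

end Averages

section Limits

variable {E : Type} [NormedAddCommGroup E] [InnerProductSpace ℝ E] [FiniteDimensional ℝ E]
  [MeasurableSpace E] [BorelSpace E]

omit [InnerProductSpace ℝ E] [FiniteDimensional ℝ E] in
lemma isTightMeasureSet_of_lintegral_sq_le [ProperSpace E] {S : Set (Measure E)} {K : ℝ≥0∞}
    (hK : K ≠ ⊤) (h : ∀ μ ∈ S, ∫⁻ x, (‖x‖₊ : ℝ≥0∞) ^ 2 ∂μ ≤ K) : IsTightMeasureSet S := by
  apply isTightMeasureSet_of_tendsto_measure_norm_gt
  have hlim : Tendsto (fun r : ℝ => K / ENNReal.ofReal r ^ 2) atTop (𝓝 0) := by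
    have h1 : Tendsto (fun r : ℝ => ENNReal.ofReal r ^ 2) atTop (𝓝 ⊤) :=
      ((ENNReal.continuous_pow 2).tendsto ⊤).comp tendsto_ofReal_atTop
    simpa using ENNReal.Tendsto.const_div h1 (Or.inr hK)
  refine tendsto_of_tendsto_of_tendsto_of_le_of_le' tendsto_const_nhds hlim
    (Eventually.of_forall fun _ => zero_le) ?_
  filter_upwards [eventually_gt_atTop 0] with r hr
  refine iSup₂_le fun μ hμ => ?_
  rw [ENNReal.le_div_iff_mul_le (by simp [hr]) (by simp), mul_comm]
  refine le_trans (le_trans ?_ (mul_meas_ge_le_lintegral₀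
    (f := fun x : E => (‖x‖₊ : ℝ≥0∞) ^ 2) (by fun_prop) (ENNReal.ofReal r ^ 2))) (h μ hμ)
  gcongr
  intro hx
  rename_i x
  gcongr
  rw [← enorm_eq_nnnorm, ← ofReal_norm]
  exact ENNReal.ofReal_le_ofReal (le_of_lt hx)

/-- Lower semicontinuity of the integral of a nonnegative continuous function under weak
convergence, for uniform bounds. -/
lemma lintegral_le_of_tendsto {X ι : Type*} [TopologicalSpace X] [MeasurableSpace X]
    [OpensMeasurableSpace X] {F : Filter ι} [F.NeBot] {P : ι → ProbabilityMeasure X}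
    {π : ProbabilityMeasure X} (hP : Tendsto P F (𝓝 π)) {f : X → NNReal} (hf : Continuous f)
    {C : ℝ≥0∞} (h : ∀ i, ∫⁻ x, f x ∂(P i : Measure X) ≤ C) :
    ∫⁻ x, f x ∂(π : Measure X) ≤ C := by
  have htrunc (x : X) : (f x : ℝ≥0∞) = ⨆ k : ℕ, ((min (f x) k : NNReal) : ℝ≥0∞) := by
    refine le_antisymm ?_ (iSup_le fun k => by exact_mod_cast min_le_left _ _)
    obtain ⟨k, hk⟩ := exists_nat_ge (f x)
    exact le_iSup_of_le k (by rw [min_eq_left hk])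
  simp_rw [htrunc]
  rw [lintegral_iSup (fun k => by fun_prop)
    (fun k l hkl x => by
      have : (k : NNReal) ≤ l := by exact_mod_cast hkl
      exact ENNReal.coe_le_coe.2 (min_le_min_left _ this))]
  refine iSup_le fun k => ?_
  let g : BoundedContinuousFunction X NNReal :=
    BoundedContinuousFunction.mkOfBound ⟨fun x => min (f x) k, by fun_prop⟩ k (fun x y => by
      rw [NNReal.dist_eq, abs_le]
      have h1 : ((min (f x) k : NNReal) : ℝ) ≤ k := by exact_mod_cast min_le_right _ _
      have h2 : ((min (f y) k : NNReal) : ℝ) ≤ k := by exact_mod_cast min_le_right _ _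
      have h3 := (min (f x) (k : NNReal)).coe_nonneg
      have h4 := (min (f y) (k : NNReal)).coe_nonneg
      constructor <;> simp only [ContinuousMap.coe_mk] <;> linarith)
  refine le_of_tendsto (ProbabilityMeasure.tendsto_iff_forall_lintegral_tendsto.1 hP g)
    (Eventually.of_forall fun i => le_trans (lintegral_mono fun x => ?_) (h i))
  exact ENNReal.coe_le_coe.2 (min_le_left _ _)

omit [FiniteDimensional ℝ E] in
/-- A weak limit is determined by the limits of the characteristic functions on a dense set. -/
lemma eq_of_tendsto_charFun_dense [CompleteSpace E] [SecondCountableTopology E] {ι : Type*}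
    {F : Filter ι} [F.NeBot] {P : ι → ProbabilityMeasure E} {π : ProbabilityMeasure E}
    (hP : Tendsto P F (𝓝 π)) {μ : Measure E} [IsFiniteMeasure μ] {D : Set E} (hD : Dense D)
    (h : ∀ t ∈ D, Tendsto (fun i => charFun (P i : Measure E) t) F (𝓝 (charFun μ t))) :
    (π : Measure E) = μ := by
  apply Measure.ext_of_charFun
  refine Continuous.ext_on hD continuous_charFun continuous_charFun fun t ht => ?_
  refine tendsto_nhds_unique ?_ (h t ht)
  simp only [charFun_eq_integral_innerProbChar]
  exact (ProbabilityMeasure.tendsto_iff_forall_integral_rclike_tendsto ℂ).1 hP _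

/-- Lower semicontinuity of the transport cost along sequences of couplings with bounded second
moments whose marginals converge in the sense of characteristic functions on a dense set. -/
lemma W2sq_le_of_tendsto_charFun {P : ℕ → ProbabilityMeasure (E × E)} {μ ν : Measure E}
    [IsFiniteMeasure μ] [IsFiniteMeasure ν] {C K L : ℝ≥0∞} (hK : K ≠ ⊤) (hL : L ≠ ⊤)
    (hC : ∀ n, ∫⁻ p, (‖p.1 - p.2‖₊ : ℝ≥0∞) ^ 2 ∂(P n : Measure (E × E)) ≤ C)
    (hPK : ∀ n, ∫⁻ x, (‖x‖₊ : ℝ≥0∞) ^ 2 ∂((P n : Measure (E × E)).map Prod.fst) ≤ K)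
    (hPL : ∀ n, ∫⁻ x, (‖x‖₊ : ℝ≥0∞) ^ 2 ∂((P n : Measure (E × E)).map Prod.snd) ≤ L)
    {D : Set E} (hD : Dense D)
    (hμ : ∀ t ∈ D, Tendsto (fun n => charFun ((P n : Measure (E × E)).map Prod.fst) t) atTop
      (𝓝 (charFun μ t)))
    (hν : ∀ t ∈ D, Tendsto (fun n => charFun ((P n : Measure (E × E)).map Prod.snd) t) atTop
      (𝓝 (charFun ν t))) :
    W2sq μ ν ≤ C := by
  have : ProperSpace E := FiniteDimensional.proper ℝ E
  have htight : IsTightMeasureSet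
      {((π : ProbabilityMeasure (E × E)) : Measure (E × E)) | π ∈ range P} := by
    apply IsTightMeasureSet.prodMk
    · apply isTightMeasureSet_of_lintegral_sq_le hK
      rintro _ ⟨_, ⟨_, ⟨n, rfl⟩, rfl⟩, rfl⟩
      exact hPK n
    · apply isTightMeasureSet_of_lintegral_sq_le hL
      rintro _ ⟨_, ⟨_, ⟨n, rfl⟩, rfl⟩, rfl⟩
      exact hPL n
  let U : Ultrafilter ℕ := hyperfilter ℕ
  have hU : (U : Filter ℕ) ≤ atTop := Nat.hyperfilter_le_atTop
  obtain ⟨π, -, hπ⟩ := (isCompact_closure_of_isTightMeasureSet htight).ultrafilter_le_nhds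
    (U.map P) (le_principal_iff.2 (mem_of_superset (Ultrafilter.mem_map.2
      (Filter.univ_mem' fun n => mem_range_self n)) subset_closure))
  have hπ' : Tendsto P U (𝓝 π) := hπ
  refine iInf₂_le_of_le (π : Measure (E × E)) ⟨?_, ?_⟩ ?_
  · exact eq_of_tendsto_charFun_dense
      (ProbabilityMeasure.tendsto_map_of_tendsto_of_continuous P π hπ' continuous_fst) hD
      fun t ht => (hμ t ht).mono_left hU
  · exact eq_of_tendsto_charFun_dense
      (ProbabilityMeasure.tendsto_map_of_tendsto_of_continuous P π hπ' continuous_snd) hD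
      fun t ht => (hν t ht).mono_left hU
  · have := lintegral_le_of_tendsto hπ' (f := fun p : E × E => ‖p.1 - p.2‖₊ ^ 2) (by fun_prop)
      (C := C) (fun n => by simpa using hC n)
    simpa using this

end Limits

section Mixtures

variable {α : Type*} [MeasurableSpace α]

/-- Strong law of large numbers for the coordinates of an infinite product. -/
lemma ae_tendsto_average_infinitePi (m : Measure α) [IsProbabilityMeasure m] {f : α → ℂ}
    (hf : Measurable f) (hfi : Integrable f m) :
    ∀ᵐ ω ∂(Measure.infinitePi fun _ : ℕ => m),
      Tendsto (fun n : ℕ => ((n + 1 : ℕ) : ℝ)⁻¹ • ∑ i ∈ Finset.range (n + 1), f (ω i)) atTop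
        (𝓝 (∫ a, f a ∂m)) := by
  have hmp (i : ℕ) := measurePreserving_eval_infinitePi (fun _ : ℕ => m) i
  have hmeas (i : ℕ) : Measurable fun ω : ℕ → α => f (ω i) := by fun_prop
  have hmap (i : ℕ) : (Measure.infinitePi fun _ : ℕ => m).map (fun ω => f (ω i)) = m.map f := by
    conv_rhs => rw [← (hmp i).map_eq]
    rw [Measure.map_map hf (hmp i).measurable]
    rfl
  have hslln := strong_law_ae (μ := Measure.infinitePi fun _ : ℕ => m)
    (fun i ω => f (ω i)) ((hmp 0).integrable_comp_of_integrable hfi)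
    (fun i j hij => (iIndepFun_infinitePi (fun _ => hf)).indepFun hij)
    (fun i => ⟨(hmeas i).aemeasurable, (hmeas 0).aemeasurable, by rw [hmap, hmap]⟩)
  have hint : ∫ ω, f (ω 0) ∂(Measure.infinitePi fun _ : ℕ => m) = ∫ a, f a ∂m := by
    conv_rhs => rw [← (hmp 0).map_eq]
    rw [integral_map (hmp 0).measurable.aemeasurable hf.aestronglyMeasurable]
  rw [hint] at hslln
  filter_upwards [hslln] with ω hω
  exact hω.comp (tendsto_add_atTop_nat 1)

variable {E : Type} [NormedAddCommGroup E] [InnerProductSpace ℝ E] [FiniteDimensional ℝ E]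
  [MeasurableSpace E] [BorelSpace E]

omit [FiniteDimensional ℝ E] in
lemma measurable_charFun_kernel [SecondCountableTopology E] (κ : Kernel α E) [IsMarkovKernel κ]
    (t : E) : Measurable fun a => charFun (κ a) t := by
  simp only [charFun_eq_integral_innerProbChar]
  exact (StronglyMeasurable.integral_kernel (κ := κ)
    (BoundedContinuousFunction.innerProbChar t).continuous.stronglyMeasurable).measurable

omit [FiniteDimensional ℝ E] in
lemma integrable_charFun_kernel [SecondCountableTopology E] (m : Measure α) [IsFiniteMeasure m]
    (κ : Kernel α E) [IsMarkovKernel κ] (t : E) : Integrable (fun a => charFun (κ a) t) m :=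
  .of_bound (measurable_charFun_kernel κ t).aestronglyMeasurable 1
    (Eventually.of_forall fun _ => norm_charFun_le_one t)

omit [FiniteDimensional ℝ E] in
lemma charFun_bind [SecondCountableTopology E] (m : Measure α) [IsFiniteMeasure m]
    (κ : Kernel α E) [IsMarkovKernel κ] (t : E) :
    charFun (m.bind κ) t = ∫ a, charFun (κ a) t ∂m := by
  simp only [charFun_eq_integral_innerProbChar]
  rw [← Measure.snd_compProd, Measure.snd, integral_map measurable_snd.aemeasurable
    (BoundedContinuousFunction.innerProbChar t).continuous.aestronglyMeasurable, Measure.integral_compProd]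
  refine Integrable.of_bound (C := 1) (((BoundedContinuousFunction.innerProbChar t).continuous.measurable.comp
    measurable_snd).aestronglyMeasurable) (Eventually.of_forall fun p => ?_)
  simp [BoundedContinuousFunction.innerProbChar_apply, Complex.norm_exp_ofReal_mul_I]

omit [InnerProductSpace ℝ E] [FiniteDimensional ℝ E] [BorelSpace E] in
lemma exists_coupling_of_W2sq_lt {μ ν : Measure E} {C : ℝ≥0∞} (h : W2sq μ ν < C) :
    ∃ π : Measure (E × E), π.map Prod.fst = μ ∧ π.map Prod.snd = ν ∧
      ∫⁻ p, (‖p.1 - p.2‖₊ : ℝ≥0∞) ^ 2 ∂π ≤ C := by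
  simp only [W2sq, iInf_lt_iff] at h
  obtain ⟨π, ⟨h1, h2⟩, h3⟩ := h
  exact ⟨π, h1, h2, h3.le⟩

/-- The squared Wasserstein distance of two mixtures is bounded by the essential supremum of
the squared distances of their components. -/
theorem W2sq_bind_le (m : Measure α) [IsProbabilityMeasure m] (κ ρ : Kernel α E)
    [IsMarkovKernel κ] [IsMarkovKernel ρ] {C K L : ℝ≥0∞} (hK : K ≠ ⊤) (hL : L ≠ ⊤)
    (hC : ∀ᵐ a ∂m, W2sq (κ a) (ρ a) ≤ C)
    (hκ : ∀ a, ∫⁻ x, (‖x‖₊ : ℝ≥0∞) ^ 2 ∂(κ a) ≤ K)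
    (hρ : ∀ a, ∫⁻ x, (‖x‖₊ : ℝ≥0∞) ^ 2 ∂(ρ a) ≤ L) :
    W2sq (m.bind κ) (m.bind ρ) ≤ C := by
  have : ProperSpace E := FiniteDimensional.proper ℝ E
  refine le_of_forall_gt fun C' hC' => ?_
  obtain ⟨C'', hCC'', hC''⟩ := exists_between hC'
  refine lt_of_le_of_lt ?_ hC''
  obtain ⟨D, hDc, hD⟩ := TopologicalSpace.exists_countable_dense E
  have hlaw (σ : Kernel α E) [IsMarkovKernel σ] : ∀ᵐ ω ∂(Measure.infinitePi fun _ : ℕ => m),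
      ∀ t ∈ D, Tendsto (fun n : ℕ => ((n + 1 : ℕ) : ℝ)⁻¹ •
        ∑ i ∈ Finset.range (n + 1), charFun (σ (ω i)) t) atTop (𝓝 (charFun (m.bind σ) t)) := by
    rw [ae_ball_iff hDc]
    intro t _
    rw [charFun_bind]
    exact ae_tendsto_average_infinitePi m (f := fun a => charFun (σ a) t)
      (measurable_charFun_kernel σ t) (integrable_charFun_kernel m σ t)
  have hcost : ∀ᵐ ω ∂(Measure.infinitePi fun _ : ℕ => m), ∀ i, W2sq (κ (ω i)) (ρ (ω i)) ≤ C :=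
    ae_all_iff.2 fun i =>
      (measurePreserving_eval_infinitePi (fun _ : ℕ => m) i).quasiMeasurePreserving.ae hC
  obtain ⟨ω, hω1, hω2, hω3⟩ := ((hlaw κ).and ((hlaw ρ).and hcost)).exists
  choose p hp1 hp2 hp3 using fun i => exists_coupling_of_W2sq_lt ((hω3 i).trans_lt hCC'')
  have hp (i : ℕ) : IsProbabilityMeasure (p i) := by
    have : IsProbabilityMeasure ((p i).map Prod.fst) := by rw [hp1]; infer_instance
    exact Measure.isProbabilityMeasure_of_map Prod.fst
  have hm1 (n : ℕ) : (avgMeasure p n).map Prod.fst = avgMeasure (fun i => κ (ω i)) n := by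
    rw [map_avgMeasure p measurable_fst]; simp only [hp1]
  have hm2 (n : ℕ) : (avgMeasure p n).map Prod.snd = avgMeasure (fun i => ρ (ω i)) n := by
    rw [map_avgMeasure p measurable_snd]; simp only [hp2]
  refine W2sq_le_of_tendsto_charFun
    (P := fun n => ⟨avgMeasure p n, isProbabilityMeasure_avgMeasure hp n⟩) hK hL
    (lintegral_avgMeasure_le hp3) (fun n => ?_) (fun n => ?_) hD
    (fun t ht => ?_) (fun t ht => ?_)
  · simpa only [ProbabilityMeasure.coe_mk, hm1] using lintegral_avgMeasure_le (fun i => hκ (ω i)) n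
  · simpa only [ProbabilityMeasure.coe_mk, hm2] using lintegral_avgMeasure_le (fun i => hρ (ω i)) n
  · simpa only [ProbabilityMeasure.coe_mk, hm1, charFun_avgMeasure
      (fun i => (inferInstance : IsProbabilityMeasure (κ (ω i))))] using hω1 t ht
  · simpa only [ProbabilityMeasure.coe_mk, hm2, charFun_avgMeasure
      (fun i => (inferInstance : IsProbabilityMeasure (ρ (ω i))))] using hω2 t ht

end Mixtures

/-- A family in `M(ℝ^d)` agrees on `[0,1]` with a Markov kernel with bounded second moments. -/
lemma MemM.exists_kernel {d : ℕ} {μ : ℝ → Measure (Ed d)} (hμ : MemM d μ) :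
    ∃ κ : Kernel ℝ (Ed d), IsMarkovKernel κ ∧ (∀ u ∈ Icc (0:ℝ) 1, κ u = μ u) ∧
      ∃ K : ℝ≥0∞, K ≠ ⊤ ∧ ∀ u, ∫⁻ x, (‖x‖₊ : ℝ≥0∞) ^ 2 ∂(κ u) ≤ K := by
  classical
  have hmeas : Measurable μ := Measure.measurable_of_measurable_coe _ hμ.meas
  let κ : Kernel ℝ (Ed d) :=
    ⟨fun u => if u ∈ Icc (0:ℝ) 1 then μ u else Measure.dirac 0,
      Measurable.ite measurableSet_Icc hmeas measurable_const⟩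
  have hin (u : ℝ) (hu : u ∈ Icc (0:ℝ) 1) : κ u = μ u := if_pos hu
  have hout (u : ℝ) (hu : u ∉ Icc (0:ℝ) 1) : κ u = Measure.dirac 0 := if_neg hu
  refine ⟨κ, ⟨fun u => ?_⟩, hin, _, hμ.moment.ne, fun u => ?_⟩
  · by_cases hu : u ∈ Icc (0:ℝ) 1
    · rw [hin u hu]; exact hμ.prob u hu
    · rw [hout u hu]; infer_instance
  · by_cases hu : u ∈ Icc (0:ℝ) 1
    · rw [hin u hu]
      exact le_iSup₂ (f := fun u (_ : u ∈ Icc (0:ℝ) 1) =>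
        ∫⁻ x, (‖x‖₊ : ℝ≥0∞) ^ 2 ∂(μ u)) u hu
    · rw [hout u hu]; simp

lemma IsGraphon.isProbabilityMeasure_withDensity {G : ℝ → ℝ → ℝ} (hG : IsGraphon G) {u : ℝ}
    (hu : u ∈ Icc (0:ℝ) 1) (hdeg : 0 < deg G u) :
    IsProbabilityMeasure ((volume.restrict (Icc (0:ℝ) 1)).withDensity
      fun v => ENNReal.ofReal (G u v) / ENNReal.ofReal (deg G u)) := by
  have hmeas : Measurable (G u) := hG.measurable.of_uncurry_left
  have hmem : ∀ᵐ v ∂(volume.restrict (Icc (0:ℝ) 1)), G u v ∈ Icc (0:ℝ) 1 :=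
    (ae_restrict_mem measurableSet_Icc).mono fun v hv => hG.mem_Icc u hu v hv
  have hint : Integrable (G u) (volume.restrict (Icc (0:ℝ) 1)) :=
    .of_bound hmeas.aestronglyMeasurable 1 (hmem.mono fun v hv => by
      rw [Real.norm_of_nonneg hv.1]; exact hv.2)
  constructor
  rw [withDensity_apply _ MeasurableSet.univ, Measure.restrict_univ]
  simp only [div_eq_mul_inv]
  rw [lintegral_mul_const _ (by fun_prop),
    ← ofReal_integral_eq_lintegral_ofReal hint (hmem.mono fun v hv => hv.1)]
  exact ENNReal.mul_inv_cancel (by simpa [deg] using hdeg) ENNReal.ofReal_ne_top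

/-- the graphon averaging operator is a contraction for the uniform
(essential-sup) Wasserstein distance. -/
theorem stmt_1 {d : ℕ} (G : ℝ → ℝ → ℝ) (hG : IsGraphon G)
    (hdeg : ∀ᵐ u ∂(volume.restrict (Set.Icc (0:ℝ) 1)), 0 < deg G u)
    (ν η : ℝ → Measure (Ed d)) (hν : MemM d ν) (hη : MemM d η) :
    essSup (fun u => W2 (graphonAvg G ν u) (graphonAvg G η u))
        (volume.restrict (Set.Icc (0:ℝ) 1)) ≤
      essSup (fun u => W2 (ν u) (η u)) (volume.restrict (Set.Icc (0:ℝ) 1)) := by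
  obtain ⟨κ, _, hκ, K, hK, hκK⟩ := hν.exists_kernel
  obtain ⟨ρ, _, hρ, L, hL, hρL⟩ := hη.exists_kernel
  set C := essSup (fun u => W2 (ν u) (η u)) (volume.restrict (Icc (0:ℝ) 1))
  have hsq : ∀ᵐ v ∂(volume.restrict (Icc (0:ℝ) 1)), W2sq (κ v) (ρ v) ≤ C ^ (2:ℝ) := by
    filter_upwards [ENNReal.ae_le_essSup (fun u => W2 (ν u) (η u)),
      ae_restrict_mem measurableSet_Icc] with v hv hvI
    rw [hκ v hvI, hρ v hvI]
    calc W2sq (ν v) (η v) = W2 (ν v) (η v) ^ (2:ℝ) := by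
          rw [W2, ← ENNReal.rpow_mul]; norm_num
      _ ≤ C ^ (2:ℝ) := ENNReal.rpow_le_rpow hv (by norm_num)
  refine essSup_le_of_ae_le C ?_
  filter_upwards [hdeg, ae_restrict_mem measurableSet_Icc] with u hu huI
  have := hG.isProbabilityMeasure_withDensity huI hu
  have hac := withDensity_absolutelyContinuous (volume.restrict (Icc (0:ℝ) 1))
    fun v => ENNReal.ofReal (G u v) / ENNReal.ofReal (deg G u)
  have hmem : ∀ᵐ v ∂_, v ∈ Icc (0:ℝ) 1 := hac.ae_le (ae_restrict_mem (μ := volume) (measurableSet_Icc (a := (0:ℝ)) (b := 1)))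
  have hνκ : graphonAvg G ν u = Measure.bind _ κ :=
    Measure.bind_congr_right (hmem.mono fun v hv => (hκ v hv).symm)
  have hηρ : graphonAvg G η u = Measure.bind _ ρ :=
    Measure.bind_congr_right (hmem.mono fun v hv => (hρ v hv).symm)
  rw [hνκ, hηρ]
  calc W2 _ _ ≤ (C ^ (2:ℝ)) ^ (1/2 : ℝ) :=
        ENNReal.rpow_le_rpow (W2sq_bind_le _ κ ρ hK hL (hac.ae_le hsq) hκK hρL) (by norm_num)
    _ = C := by rw [← ENNReal.rpow_mul]; norm_num

end
end

section
/- Let G be a graphon, let u ∈ [0,1] with ‖G(u,·)‖₁ > 0, and let ν, η ∈ M(ℝ^d) be such that v ↦ W₂²(ν^v, η^v) is Lebesgue-measurable. Then the squared 2-Wasserstein distance between the graphon-averaged measures is dominated by the graphon average of the squared Wasserstein distances: W₂²([Gν]^u, [Gη]^u) ≤ ‖G(u,·)‖₁^{-1} ∫₀¹ G(u,v) W₂²(ν^v, η^v) dv. -/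
open MeasureTheory ENNReal Set Filter

noncomputable section

open ProbabilityTheory

open scoped NNReal

theorem exists_nnrat_le_mul_tsub_le {x w ε : ℝ≥0∞} (hx : x ≠ ⊤) (hw : w ≠ ⊤) (hε : 0 < ε) :
    ∃ q : ℚ≥0, ((q : ℝ≥0) : ℝ≥0∞) ≤ x ∧ w * (x - ((q : ℝ≥0) : ℝ≥0∞)) ≤ ε := by
  rcases eq_or_ne x 0 with rfl | hx0
  · exact ⟨0, by simp⟩
  · have hr : 0 < ε / w := ENNReal.div_pos hε.ne' hw
    obtain ⟨q, hq0, hq1, hq2⟩ := ENNReal.lt_iff_exists_rat_btwn.1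
      (ENNReal.sub_lt_self hx hx0 hr.ne')
    lift q to ℚ≥0 using hq0
    have hcast : (((q : ℚ) : ℝ).toNNReal : ℝ≥0∞) = ((q : ℝ≥0) : ℝ≥0∞) := by
      congr 1
      apply NNReal.coe_injective
      rw [Real.coe_toNNReal _ (by positivity)]
      simp
      rfl
    rw [hcast] at hq1 hq2
    refine ⟨q, hq2.le, ?_⟩
    have : x - ((q : ℝ≥0) : ℝ≥0∞) ≤ ε / w := by
      rw [tsub_le_iff_right, add_comm, ← tsub_le_iff_right]
      exact hq1.le
    calc w * (x - ((q : ℝ≥0) : ℝ≥0∞)) ≤ w * (ε / w) := by gcongr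
      _ ≤ ε := ENNReal.mul_div_le

/-- A nonnegative summable family is approximated from below, in weighted `ℓ¹`, by finitely
supported rational families. -/
theorem exists_finsupp_nnrat_le_tsum_le {ι : Type*} [Countable ι] {p w : ι → ℝ≥0∞}
    (hp : ∀ i, p i ≠ ⊤) (hw : ∀ i, w i ≠ ⊤) (hsum : ∑' i, w i * p i ≠ ⊤) {ε : ℝ≥0∞}
    (hε : 0 < ε) :
    ∃ q : ι →₀ ℚ≥0, (∀ i, ((q i : ℝ≥0) : ℝ≥0∞) ≤ p i) ∧
      ∑' i, w i * (p i - ((q i : ℝ≥0) : ℝ≥0∞)) ≤ ε := by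
  classical
  obtain ⟨e, he0, he⟩ := ENNReal.exists_pos_sum_of_countable (ENNReal.half_pos hε.ne').ne' ι
  choose r hr hr' using fun i =>
    exists_nnrat_le_mul_tsub_le (hp i) (hw i) (ENNReal.coe_pos.2 (he0 i))
  obtain ⟨s, hs⟩ := ((ENNReal.tendsto_tsum_compl_atTop_zero hsum).eventually
    (gt_mem_nhds (ENNReal.half_pos hε.ne'))).exists
  refine ⟨Finsupp.onFinset s (fun i => if i ∈ s then r i else 0) (by simp +contextual),
    fun i => ?_, ?_⟩
  · by_cases h : i ∈ s <;> simp [h, hr]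
  · have hb : ∀ i, w i * (p i - (((Finsupp.onFinset s (fun i => if i ∈ s then r i else 0)
        (by simp +contextual) : ι →₀ ℚ≥0) i : ℝ≥0) : ℝ≥0∞)) ≤
        (e i : ℝ≥0∞) + (sᶜ : Set ι).indicator (fun i => w i * p i) i := by
      intro i
      by_cases h : i ∈ s
      · simpa [h] using hr' i
      · simp [h]
    calc _ ≤ ∑' i, ((e i : ℝ≥0∞) + (sᶜ : Set ι).indicator (fun i => w i * p i) i) :=
          ENNReal.tsum_le_tsum hb
      _ = ∑' i, (e i : ℝ≥0∞) + ∑' i : { x // x ∉ s }, w i * p i := by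
          rw [ENNReal.tsum_add, ← tsum_subtype]
          rfl
      _ ≤ ε / 2 + ε / 2 := by gcongr
      _ = ε := ENNReal.add_halves ε

/-- Completion of a partial discrete coupling `q` of `a` and `b` by the normalised product of
the residual marginals. -/
def completeCoupling (q : ℕ → ℕ → ℝ≥0∞) (a b : ℕ → ℝ≥0∞) (i j : ℕ) : ℝ≥0∞ :=
  q i j + (a i - ∑' k, q i k) * (b j - ∑' k, q k j) / (1 - ∑' k, ∑' l, q k l)

theorem completeCoupling_swap (q : ℕ → ℕ → ℝ≥0∞) (a b : ℕ → ℝ≥0∞) (i j : ℕ) :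
    completeCoupling q a b i j = completeCoupling (fun k l => q l k) b a j i := by
  simp only [completeCoupling]
  rw [mul_comm, ENNReal.tsum_comm]

theorem tsum_tsub_row {q : ℕ → ℕ → ℝ≥0∞} {a : ℕ → ℝ≥0∞} (ha : ∑' i, a i = 1)
    (hr : ∀ i, ∑' k, q i k ≤ a i) :
    ∑' i, (a i - ∑' k, q i k) = 1 - ∑' k, ∑' l, q k l := by
  rw [ENNReal.tsum_sub _ hr, ha]
  exact ((ENNReal.tsum_le_tsum hr).trans (ha.le)).trans_lt one_lt_top |>.ne

theorem tsum_tsub_col {q : ℕ → ℕ → ℝ≥0∞} {b : ℕ → ℝ≥0∞} (hb : ∑' j, b j = 1)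
    (hs : ∀ j, ∑' k, q k j ≤ b j) :
    ∑' j, (b j - ∑' k, q k j) = 1 - ∑' k, ∑' l, q k l := by
  rw [ENNReal.tsum_comm]
  exact tsum_tsub_row (q := fun j k => q k j) hb hs

theorem tsum_mul_div_le {x : ℝ≥0∞} {y : ℕ → ℝ≥0∞} {m : ℝ≥0∞} (hy : ∑' j, y j = m) :
    ∑' j, x * y j / m ≤ x := by
  simp only [div_eq_mul_inv, mul_assoc]
  rw [ENNReal.tsum_mul_left, ENNReal.tsum_mul_right, hy, ← div_eq_mul_inv]
  exact mul_le_of_le_one_right' ENNReal.div_self_le_one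

theorem completeCoupling_row {q : ℕ → ℕ → ℝ≥0∞} {a b : ℕ → ℝ≥0∞} (ha : ∑' i, a i = 1)
    (hb : ∑' j, b j = 1) (hr : ∀ i, ∑' k, q i k ≤ a i) (hs : ∀ j, ∑' k, q k j ≤ b j) (i : ℕ) :
    ∑' j, completeCoupling q a b i j = a i := by
  have h1 := tsum_tsub_row ha hr
  simp only [completeCoupling]
  rw [ENNReal.tsum_add]
  simp only [div_eq_mul_inv, mul_assoc]
  rw [ENNReal.tsum_mul_left, ENNReal.tsum_mul_right, tsum_tsub_col hb hs]
  rcases eq_or_ne (1 - ∑' k, ∑' l, q k l) 0 with h0 | h0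
  · rw [h0] at h1 ⊢
    rw [ENNReal.tsum_eq_zero.1 h1 i, zero_mul, add_zero]
    exact le_antisymm (hr i) (tsub_eq_zero_iff_le.1 (ENNReal.tsum_eq_zero.1 h1 i))
  · rw [ENNReal.mul_inv_cancel h0 (by simp), mul_one, add_tsub_cancel_of_le (hr i)]

theorem completeCoupling_col {q : ℕ → ℕ → ℝ≥0∞} {a b : ℕ → ℝ≥0∞} (ha : ∑' i, a i = 1)
    (hb : ∑' j, b j = 1) (hr : ∀ i, ∑' k, q i k ≤ a i) (hs : ∀ j, ∑' k, q k j ≤ b j) (j : ℕ) :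
    ∑' i, completeCoupling q a b i j = b j := by
  simp only [fun i => completeCoupling_swap q a b i j]
  exact completeCoupling_row hb ha hs hr j

theorem tsum_cost_completeCoupling_le {q C : ℕ → ℕ → ℝ≥0∞} {a b α β : ℕ → ℝ≥0∞}
    (ha : ∑' i, a i = 1) (hb : ∑' j, b j = 1) (hr : ∀ i, ∑' k, q i k ≤ a i)
    (hs : ∀ j, ∑' k, q k j ≤ b j) (hC : ∀ i j, C i j ≤ α i + β j) :
    ∑' i, ∑' j, C i j * completeCoupling q a b i j ≤
      ∑' i, ∑' j, C i j * q i j +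
        (∑' i, α i * (a i - ∑' k, q i k) + ∑' j, β j * (b j - ∑' k, q k j)) := by
  set m := 1 - ∑' k, ∑' l, q k l with hm
  set x := fun i => a i - ∑' k, q i k
  set y := fun j => b j - ∑' k, q k j
  have hx : ∑' i, x i = m := tsum_tsub_row ha hr
  have hy : ∑' j, y j = m := tsum_tsub_col hb hs
  have hle : ∀ i j, C i j * completeCoupling q a b i j ≤
      C i j * q i j + (α i * (x i * y j / m) + β j * (y j * x i / m)) := by
    intro i j
    rw [completeCoupling, mul_add, mul_comm (y j), ← add_mul]
    gcongr
    exact hC i j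
  refine (ENNReal.tsum_le_tsum fun i => ENNReal.tsum_le_tsum (hle i)).trans ?_
  simp only [ENNReal.tsum_add]
  gcongr ∑' i, ∑' j, C i j * q i j + (?_ + ?_)
  · refine ENNReal.tsum_le_tsum fun i => ?_
    rw [ENNReal.tsum_mul_left]
    gcongr
    exact tsum_mul_div_le hy
  · rw [ENNReal.tsum_comm]
    refine ENNReal.tsum_le_tsum fun j => ?_
    rw [ENNReal.tsum_mul_left]
    gcongr
    exact tsum_mul_div_le hx

/-- The real matrix underlying a finitely supported rational one. -/
def nnratMatrix (q : ℕ × ℕ →₀ ℚ≥0) (i j : ℕ) : ℝ≥0∞ := ((q (i, j) : ℝ≥0) : ℝ≥0∞)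

/-- Every discrete coupling is nearly matched in cost by the completion of a finitely supported
rational partial coupling. -/
theorem exists_completeCoupling_cost_le {p C : ℕ → ℕ → ℝ≥0∞} {a b α β : ℕ → ℝ≥0∞}
    (ha : ∑' i, a i = 1) (hb : ∑' j, b j = 1) (hpa : ∀ i, ∑' j, p i j = a i)
    (hpb : ∀ j, ∑' i, p i j = b j) (hC : ∀ i j, C i j ≤ α i + β j)
    (hα : ∀ i, α i ≠ ⊤) (hβ : ∀ j, β j ≠ ⊤) (hαa : ∑' i, α i * a i ≠ ⊤)
    (hβb : ∑' j, β j * b j ≠ ⊤) {ε : ℝ≥0∞} (hε : 0 < ε) :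
    ∃ q : ℕ × ℕ →₀ ℚ≥0, (∀ i, ∑' k, nnratMatrix q i k ≤ a i) ∧
      (∀ j, ∑' k, nnratMatrix q k j ≤ b j) ∧
      ∑' i, ∑' j, C i j * completeCoupling (nnratMatrix q) a b i j ≤
        ∑' i, ∑' j, C i j * p i j + ε := by
  have ha1 : ∀ i, a i ≠ ⊤ := fun i =>
    ((ENNReal.le_tsum i).trans_lt (ha ▸ one_lt_top)).ne
  have hb1 : ∀ i, b i ≠ ⊤ := fun i =>
    ((ENNReal.le_tsum i).trans_lt (hb ▸ one_lt_top)).ne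
  have hp1 : ∀ i j, p i j ≠ ⊤ := fun i j =>
    ((ENNReal.le_tsum j).trans_lt (hpa i ▸ (ha1 i).lt_top)).ne
  have hsplit : ∀ f : ℕ → ℕ → ℝ≥0∞, ∑' z : ℕ × ℕ, (α z.1 + β z.2) * f z.1 z.2 =
      ∑' i, α i * ∑' j, f i j + ∑' j, β j * ∑' i, f i j := by
    intro f
    simp only [add_mul]
    rw [ENNReal.tsum_add, ENNReal.tsum_prod (f := fun i j => α i * f i j),
      ENNReal.tsum_prod (f := fun i j => β j * f i j),
      ENNReal.tsum_comm (f := fun i j => β j * f i j)]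
    simp only [ENNReal.tsum_mul_left]
  obtain ⟨q, hq, hqε⟩ := exists_finsupp_nnrat_le_tsum_le (p := fun z : ℕ × ℕ => p z.1 z.2)
    (w := fun z => α z.1 + β z.2) (fun z => hp1 _ _)
    (fun z => ENNReal.add_ne_top.2 ⟨hα _, hβ _⟩)
    (by rw [hsplit]; simp only [hpa, hpb]; exact ENNReal.add_ne_top.2 ⟨hαa, hβb⟩) hε
  have hq' : ∀ i j, nnratMatrix q i j ≤ p i j := fun i j => hq (i, j)
  have hr : ∀ i, ∑' k, nnratMatrix q i k ≤ a i := fun i =>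
    (ENNReal.tsum_le_tsum (hq' i)).trans (hpa i).le
  have hs : ∀ j, ∑' k, nnratMatrix q k j ≤ b j := fun j =>
    (ENNReal.tsum_le_tsum fun k => hq' k j).trans (hpb j).le
  refine ⟨q, hr, hs, (tsum_cost_completeCoupling_le ha hb hr hs hC).trans ?_⟩
  gcongr
  · exact hq' _ _
  · refine le_of_eq_of_le ?_ hqε
    refine Eq.trans ?_ (hsplit fun i j => p i j - nnratMatrix q i j).symm
    congr 1
    · refine tsum_congr fun i => ?_
      rw [ENNReal.tsum_sub ((hr i).trans_lt (ha1 i).lt_top).ne (hq' i), hpa]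
    · refine tsum_congr fun j => ?_
      rw [ENNReal.tsum_sub ((hs j).trans_lt (hb1 j).lt_top).ne (fun i => hq' i j), hpb]

/-- Measurable selection of nearly optimal discrete couplings. -/
theorem exists_measurable_discrete_coupling {Ω : Type*} [MeasurableSpace Ω]
    {C : ℕ → ℕ → ℝ≥0∞} {α β : ℕ → ℝ≥0∞} {a b : Ω → ℕ → ℝ≥0∞} {W : Ω → ℝ≥0∞}
    (hma : ∀ i, Measurable fun v => a v i) (hmb : ∀ j, Measurable fun v => b v j)
    (hW : Measurable W)
    (ha : ∀ v, ∑' i, a v i = 1) (hb : ∀ v, ∑' j, b v j = 1)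
    (hC : ∀ i j, C i j ≤ α i + β j) (hα : ∀ i, α i ≠ ⊤) (hβ : ∀ j, β j ≠ ⊤)
    (hαa : ∀ v, ∑' i, α i * a v i ≠ ⊤) (hβb : ∀ v, ∑' j, β j * b v j ≠ ⊤)
    (hex : ∀ v, ∃ p : ℕ → ℕ → ℝ≥0∞, (∀ i, ∑' j, p i j = a v i) ∧
      (∀ j, ∑' i, p i j = b v j) ∧ ∑' i, ∑' j, C i j * p i j ≤ W v)
    {ε : ℝ≥0∞} (hε : 0 < ε) :
    ∃ P : Ω → ℕ → ℕ → ℝ≥0∞, (∀ i j, Measurable fun v => P v i j) ∧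
      ∀ v, (∀ i, ∑' j, P v i j = a v i) ∧ (∀ j, ∑' i, P v i j = b v j) ∧
        ∑' i, ∑' j, C i j * P v i j ≤ W v + ε := by
  classical
  obtain ⟨e, he⟩ := exists_surjective_nat (ℕ × ℕ →₀ ℚ≥0)
  let good : Ω → ℕ → Prop := fun v n =>
    (∀ i, ∑' k, nnratMatrix (e n) i k ≤ a v i) ∧ (∀ j, ∑' k, nnratMatrix (e n) k j ≤ b v j) ∧
      ∑' i, ∑' j, C i j * completeCoupling (nnratMatrix (e n)) (a v) (b v) i j ≤ W v + ε
  have hmeas : ∀ n i j, Measurable fun v =>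
      completeCoupling (nnratMatrix (e n)) (a v) (b v) i j := by
    intro n i j
    exact (((hma i).sub_const _).mul ((hmb j).sub_const _)).div_const _ |>.const_add _
  have hgood : ∀ v, ∃ n, good v n := by
    intro v
    obtain ⟨p, hpa, hpb, hp⟩ := hex v
    obtain ⟨q, hr, hs, hq⟩ := exists_completeCoupling_cost_le (ha v) (hb v) hpa hpb hC hα hβ
      (hαa v) (hβb v) hε
    obtain ⟨n, rfl⟩ := he q
    exact ⟨n, hr, hs, hq.trans (by gcongr)⟩
  have hgm : ∀ n, MeasurableSet {v | good v n} := by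
    intro n
    have h1 : Measurable fun v => ∀ i, ∑' k, nnratMatrix (e n) i k ≤ a v i :=
      Measurable.forall fun i => measurableSet_setOfPred.1 (measurableSet_le measurable_const (hma i))
    have h2 : Measurable fun v => ∀ j, ∑' k, nnratMatrix (e n) k j ≤ b v j :=
      Measurable.forall fun j => measurableSet_setOfPred.1 (measurableSet_le measurable_const (hmb j))
    exact measurableSet_setOfPred.2 (h1.and (h2.and (measurableSet_setOfPred.1
      (measurableSet_le (Measurable.tsum fun i => Measurable.tsum fun j =>
        (hmeas n i j).const_mul _) (hW.add_const _)))))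
  have hN : Measurable fun v => Nat.find (hgood v) := measurable_find hgood hgm
  refine ⟨fun v => completeCoupling (nnratMatrix (e (Nat.find (hgood v)))) (a v) (b v),
    fun i j => ?_, fun v => ?_⟩
  · exact (measurable_from_prod_countable_right (f := fun z : ℕ × Ω =>
      completeCoupling (nnratMatrix (e z.1)) (a z.2) (b z.2) i j) fun n => hmeas n i j).comp
      (hN.prodMk measurable_id)
  · obtain ⟨hr, hs, hc⟩ := Nat.find_spec (hgood v)
    exact ⟨completeCoupling_row (ha v) (hb v) hr hs, completeCoupling_col (ha v) (hb v) hr hs, hc⟩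

theorem lintegral_comp_nat {E : Type*} [MeasurableSpace E] (μ : Measure E) {c : E → ℕ}
    (hc : Measurable c) (f : ℕ → ℝ≥0∞) :
    ∫⁻ x, f (c x) ∂μ = ∑' i, f i * μ (c ⁻¹' {i}) := by
  rw [← lintegral_map (Measurable.of_discrete (f := f)) hc, lintegral_countable']
  simp only [Measure.map_apply hc (measurableSet_singleton _)]

theorem tsum_measure_fiber {E : Type*} [MeasurableSpace E] (μ : Measure E) {c : E → ℕ}
    (hc : Measurable c) : ∑' i, μ (c ⁻¹' {i}) = μ univ := by
  simpa using (lintegral_comp_nat μ hc fun _ => 1).symm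

theorem ae_measure_fiber_ne_zero {E : Type*} [MeasurableSpace E] (μ : Measure E) (c : E → ℕ) :
    ∀ᵐ x ∂μ, μ (c ⁻¹' {c x}) ≠ 0 := by
  have h : μ (⋃ i ∈ {i | μ (c ⁻¹' {i}) = 0}, c ⁻¹' {i}) = 0 :=
    (measure_biUnion_null_iff (to_countable _)).2 fun i hi => hi
  refine measure_mono_null (fun x hx => ?_) h
  simp only [mem_iUnion]
  exact ⟨c x, not_not.1 hx, rfl⟩

/-- The density, with respect to `μ.prod ν`, of the coupling giving mass `p i j` to the product
of the `i`-th and `j`-th cells, with conditionally independent coordinates on each such block. -/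
def blockDensity {E : Type*} [MeasurableSpace E] (μ ν : Measure E) (c : E → ℕ)
    (p : ℕ → ℕ → ℝ≥0∞) (z : E × E) : ℝ≥0∞ :=
  p (c z.1) (c z.2) / (μ (c ⁻¹' {c z.1}) * ν (c ⁻¹' {c z.2}))

theorem measurable_blockDensity {E : Type*} [MeasurableSpace E] (μ ν : Measure E) {c : E → ℕ}
    (hc : Measurable c) (p : ℕ → ℕ → ℝ≥0∞) : Measurable (blockDensity μ ν c p) :=
  (Measurable.of_discrete (f := fun n : ℕ × ℕ =>
    p n.1 n.2 / (μ (c ⁻¹' {n.1}) * ν (c ⁻¹' {n.2})))).comp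
      ((hc.comp measurable_fst).prodMk (hc.comp measurable_snd))

theorem tsum_block_eq_one {x : ℝ≥0∞} {p b : ℕ → ℝ≥0∞} (hx : x ≠ 0) (hx' : x ≠ ⊤)
    (hp : ∑' j, p j = x) (hb : ∀ j, b j ≠ ⊤) (h0 : ∀ j, b j = 0 → p j = 0) :
    ∑' j, p j / (x * b j) * b j = 1 := by
  have : ∀ j, p j / (x * b j) * b j = p j * x⁻¹ := by
    intro j
    rcases eq_or_ne (b j) 0 with h | h
    · simp [h, h0 j h]
    · rw [div_eq_mul_inv, ENNReal.mul_inv (.inl hx) (.inl hx'), mul_assoc, mul_assoc,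
        ENNReal.inv_mul_cancel h (hb j), mul_one]
  simp only [this]
  rw [ENNReal.tsum_mul_right, hp, ENNReal.mul_inv_cancel hx hx']

theorem map_fst_blockDensity {E : Type*} [MeasurableSpace E] (μ ν : Measure E)
    [IsFiniteMeasure μ] [IsFiniteMeasure ν] {c : E → ℕ} (hc : Measurable c)
    {p : ℕ → ℕ → ℝ≥0∞} (hpa : ∀ i, ∑' j, p i j = μ (c ⁻¹' {i}))
    (hpb : ∀ j, ∑' i, p i j = ν (c ⁻¹' {j})) :
    ((μ.prod ν).withDensity (blockDensity μ ν c p)).map Prod.fst = μ := by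
  ext B hB
  rw [Measure.map_apply measurable_fst hB, withDensity_apply _ (measurable_fst hB), ← prod_univ,
    ← Measure.prod_restrict, Measure.restrict_univ,
    lintegral_prod _ (measurable_blockDensity μ ν hc p).aemeasurable]
  have : ∀ᵐ x ∂(μ.restrict B), ∫⁻ y, blockDensity μ ν c p (x, y) ∂ν = 1 := by
    filter_upwards [ae_restrict_of_ae (ae_measure_fiber_ne_zero μ c)] with x hx
    exact (lintegral_comp_nat ν hc fun j =>
      p (c x) j / (μ (c ⁻¹' {c x}) * ν (c ⁻¹' {j}))).trans
        (tsum_block_eq_one hx (measure_ne_top _ _) (hpa _) (fun j => measure_ne_top _ _)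
          fun j hj => ENNReal.tsum_eq_zero.1 ((hpb j).trans hj) _)
  rw [lintegral_congr_ae this]
  simp

theorem map_snd_blockDensity {E : Type*} [MeasurableSpace E] (μ ν : Measure E)
    [IsFiniteMeasure μ] [IsFiniteMeasure ν] {c : E → ℕ} (hc : Measurable c)
    {p : ℕ → ℕ → ℝ≥0∞} (hpa : ∀ i, ∑' j, p i j = μ (c ⁻¹' {i}))
    (hpb : ∀ j, ∑' i, p i j = ν (c ⁻¹' {j})) :
    ((μ.prod ν).withDensity (blockDensity μ ν c p)).map Prod.snd = ν := by
  ext B hB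
  rw [Measure.map_apply measurable_snd hB, withDensity_apply _ (measurable_snd hB), ← univ_prod,
    ← Measure.prod_restrict, Measure.restrict_univ,
    lintegral_prod_symm _ (measurable_blockDensity μ ν hc p).aemeasurable]
  have : ∀ᵐ y ∂(ν.restrict B), ∫⁻ x, blockDensity μ ν c p (x, y) ∂μ = 1 := by
    filter_upwards [ae_restrict_of_ae (ae_measure_fiber_ne_zero ν c)] with y hy
    refine (lintegral_comp_nat μ hc fun i =>
      p i (c y) / (μ (c ⁻¹' {i}) * ν (c ⁻¹' {c y}))).trans ?_
    simp only [mul_comm _ (ν (c ⁻¹' {c y}))]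
    exact tsum_block_eq_one hy (measure_ne_top _ _) (hpb _) (fun j => measure_ne_top _ _)
      fun i hi => ENNReal.tsum_eq_zero.1 ((hpa i).trans hi) _
  rw [lintegral_congr_ae this]
  simp

theorem lintegral_blockDensity_le {E : Type*} [MeasurableSpace E] (μ ν : Measure E)
    [IsFiniteMeasure μ] [IsFiniteMeasure ν] {c : E → ℕ} (hc : Measurable c)
    (p C : ℕ → ℕ → ℝ≥0∞) :
    ∫⁻ z, C (c z.1) (c z.2) ∂((μ.prod ν).withDensity (blockDensity μ ν c p)) ≤
      ∑' i, ∑' j, C i j * p i j := by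
  have hcc : Measurable fun z : E × E => (c z.1, c z.2) :=
    (hc.comp measurable_fst).prodMk (hc.comp measurable_snd)
  have hC : Measurable fun z : E × E => C (c z.1) (c z.2) :=
    (Measurable.of_discrete (f := fun n : ℕ × ℕ => C n.1 n.2)).comp hcc
  rw [lintegral_withDensity_eq_lintegral_mul _ (measurable_blockDensity μ ν hc p) hC,
    lintegral_prod _ ((measurable_blockDensity μ ν hc p).mul hC).aemeasurable]
  have : ∀ x, ∫⁻ y, (blockDensity μ ν c p * fun z : E × E => C (c z.1) (c z.2)) (x, y) ∂ν =
      ∑' j, p (c x) j / (μ (c ⁻¹' {c x}) * ν (c ⁻¹' {j})) * C (c x) j * ν (c ⁻¹' {j}) :=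
    fun x => lintegral_comp_nat ν hc fun j =>
      p (c x) j / (μ (c ⁻¹' {c x}) * ν (c ⁻¹' {j})) * C (c x) j
  simp only [this]
  rw [lintegral_comp_nat μ hc fun i =>
    ∑' j, p i j / (μ (c ⁻¹' {i}) * ν (c ⁻¹' {j})) * C i j * ν (c ⁻¹' {j})]
  refine ENNReal.tsum_le_tsum fun i => ?_
  rw [← ENNReal.tsum_mul_right]
  refine ENNReal.tsum_le_tsum fun j => ?_
  calc p i j / (μ (c ⁻¹' {i}) * ν (c ⁻¹' {j})) * C i j * ν (c ⁻¹' {j}) * μ (c ⁻¹' {i})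
      = C i j * (μ (c ⁻¹' {i}) * ν (c ⁻¹' {j}) *
          (p i j / (μ (c ⁻¹' {i}) * ν (c ⁻¹' {j})))) := by ring
    _ ≤ C i j * p i j := by
      gcongr
      exact ENNReal.mul_div_le

theorem measurable_comp_nat {Ω E : Type*} [MeasurableSpace Ω] [MeasurableSpace E] {c : E → ℕ}
    (hc : Measurable c) {f : Ω → ℕ → ℕ → ℝ≥0∞} (hf : ∀ i j, Measurable fun v => f v i j) :
    Measurable fun z : Ω × E × E => f z.1 (c z.2.1) (c z.2.2) :=
  (measurable_from_prod_countable_left (f := fun w : Ω × ℕ × ℕ => f w.1 w.2.1 w.2.2)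
    fun n => hf n.1 n.2).comp (measurable_fst.prodMk
      ((hc.comp (measurable_fst.comp measurable_snd)).prodMk
        (hc.comp (measurable_snd.comp measurable_snd))))

/-- A measurable family of discrete couplings of the cell masses lifts to a kernel of couplings. -/
theorem exists_kernel_coupling_of_discrete {Ω E : Type*} [MeasurableSpace Ω] [MeasurableSpace E]
    (κ η : Kernel Ω E) [IsMarkovKernel κ] [IsMarkovKernel η] {c : E → ℕ} (hc : Measurable c)
    {P : Ω → ℕ → ℕ → ℝ≥0∞} (hP : ∀ i j, Measurable fun v => P v i j)
    (hPa : ∀ v i, ∑' j, P v i j = κ v (c ⁻¹' {i}))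
    (hPb : ∀ v j, ∑' i, P v i j = η v (c ⁻¹' {j})) :
    ∃ π : Kernel Ω (E × E), ∀ v, (π v).map Prod.fst = κ v ∧ (π v).map Prod.snd = η v ∧
      ∀ C : ℕ → ℕ → ℝ≥0∞, ∫⁻ z, C (c z.1) (c z.2) ∂(π v) ≤ ∑' i, ∑' j, C i j * P v i j := by
  have hm : Measurable (Function.uncurry fun v => blockDensity (κ v) (η v) c (P v)) :=
    measurable_comp_nat hc (f := fun v i j => P v i j / (κ v (c ⁻¹' {i}) * η v (c ⁻¹' {j})))
      fun i j => (hP i j).div ((κ.measurable_coe (hc (measurableSet_singleton _))).mul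
        (η.measurable_coe (hc (measurableSet_singleton _))))
  refine ⟨(κ ×ₖ η).withDensity fun v => blockDensity (κ v) (η v) c (P v), fun v => ?_⟩
  rw [Kernel.withDensity_apply _ hm, Kernel.prod_apply]
  exact ⟨map_fst_blockDensity _ _ hc (hPa v) (hPb v), map_snd_blockDensity _ _ hc (hPa v) (hPb v),
    lintegral_blockDensity_le _ _ hc (P v)⟩

theorem exists_measurable_nat_approx {E : Type*} [NormedAddCommGroup E] [MeasurableSpace E]
    [BorelSpace E] [SecondCountableTopology E] {δ : ℝ≥0} (hδ : 0 < δ) :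
    ∃ (c : E → ℕ) (x : ℕ → E), Measurable c ∧ ∀ y, ‖y - x (c y)‖₊ ≤ δ := by
  classical
  have hex : ∀ y : E, ∃ n, dist y (TopologicalSpace.denseSeq E n) < δ := fun y =>
    (TopologicalSpace.denseRange_denseSeq E).exists_dist_lt y (by exact_mod_cast hδ)
  refine ⟨fun y => Nat.find (hex y), TopologicalSpace.denseSeq E,
    measurable_find hex fun n => Metric.isOpen_ball.measurableSet, fun y => ?_⟩
  have := (Nat.find_spec (hex y)).le
  rwa [dist_eq_norm] at this

theorem W2sq_exists_coupling {E : Type} [NormedAddCommGroup E] [MeasurableSpace E]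
    (μ ν : Measure E) [IsProbabilityMeasure μ] [IsProbabilityMeasure ν] {ε : ℝ≥0∞} (hε : 0 < ε) :
    ∃ π : Measure (E × E), π.map Prod.fst = μ ∧ π.map Prod.snd = ν ∧
      ∫⁻ p, (‖p.1 - p.2‖₊ : ℝ≥0∞) ^ 2 ∂π ≤ W2sq μ ν + ε := by
  by_cases h : W2sq μ ν = ⊤
  · exact ⟨μ.prod ν, by simp [Measure.map_fst_prod], by simp [Measure.map_snd_prod], by simp [h]⟩
  · have hlt : W2sq μ ν < W2sq μ ν + ε := ENNReal.lt_add_right h hε.ne'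
    nth_rw 1 [W2sq] at hlt
    simp only [iInf_lt_iff] at hlt
    obtain ⟨π, ⟨h1, h2⟩, h3⟩ := hlt
    exact ⟨π, h1, h2, h3.le⟩

/-- The masses given to products of cells by a coupling form a discrete coupling. -/
theorem discrete_coupling_of_coupling {E : Type*} [MeasurableSpace E] {μ ν : Measure E}
    {π : Measure (E × E)} (h1 : π.map Prod.fst = μ) (h2 : π.map Prod.snd = ν) {c : E → ℕ}
    (hc : Measurable c) :
    ∃ p : ℕ → ℕ → ℝ≥0∞, (∀ i, ∑' j, p i j = μ (c ⁻¹' {i})) ∧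
      (∀ j, ∑' i, p i j = ν (c ⁻¹' {j})) ∧
      ∀ C : ℕ → ℕ → ℝ≥0∞, ∑' i, ∑' j, C i j * p i j = ∫⁻ z, C (c z.1) (c z.2) ∂π := by
  have hcc : Measurable fun z : E × E => (c z.1, c z.2) :=
    (hc.comp measurable_fst).prodMk (hc.comp measurable_snd)
  have key : ∀ C : ℕ → ℕ → ℝ≥0∞, ∑' i, ∑' j, C i j *
      π ((fun z : E × E => (c z.1, c z.2)) ⁻¹' {(i, j)}) = ∫⁻ z, C (c z.1) (c z.2) ∂π := by
    intro C
    rw [← lintegral_map (f := fun n : ℕ × ℕ => C n.1 n.2) Measurable.of_discrete hcc,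
      lintegral_countable', ENNReal.tsum_prod']
    simp only [Measure.map_apply hcc (measurableSet_singleton _)]
  refine ⟨fun i j => π ((fun z : E × E => (c z.1, c z.2)) ⁻¹' {(i, j)}), fun i => ?_, fun j => ?_,
    key⟩
  · have := key fun k _ => if k = i then 1 else 0
    simp only [ite_mul, one_mul, zero_mul] at this
    rw [tsum_eq_single i (by simp +contextual)] at this
    simp only [if_true] at this
    rw [this, ← h1, ← lintegral_map (f := fun x => if c x = i then (1 : ℝ≥0∞) else 0)
      ((Measurable.of_discrete (f := fun k => if k = i then (1 : ℝ≥0∞) else 0)).comp hc)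
      measurable_fst, lintegral_comp_nat _ hc fun k => if k = i then 1 else 0,
      tsum_eq_single i (by simp +contextual)]
    simp
  · have := key fun _ k => if k = j then 1 else 0
    rw [ENNReal.tsum_comm] at this
    simp only [ite_mul, one_mul, zero_mul] at this
    rw [tsum_eq_single j (by simp +contextual)] at this
    simp only [if_true] at this
    rw [this, ← h2, ← lintegral_map (f := fun x => if c x = j then (1 : ℝ≥0∞) else 0)
      ((Measurable.of_discrete (f := fun k => if k = j then (1 : ℝ≥0∞) else 0)).comp hc)
      measurable_snd, lintegral_comp_nat _ hc fun k => if k = j then 1 else 0,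
      tsum_eq_single j (by simp +contextual)]
    simp

theorem add_four_mul_sq_le {δ t : ℝ≥0} (hδ : δ ≤ 1) :
    (t + 4 * δ) ^ 2 ≤ (1 + 4 * δ) * t ^ 2 + 20 * δ := by
  rw [← NNReal.coe_le_coe] at hδ ⊢
  push_cast at *
  nlinarith [δ.2, mul_nonneg δ.2 (sq_nonneg ((t : ℝ) - 1)), mul_nonneg δ.2 (sub_nonneg.2 hδ)]

theorem add_add_two_mul_sq_le (s t δ : ℝ≥0) :
    (s + t + 2 * δ) ^ 2 ≤ (3 * s ^ 2 + 6 * δ ^ 2) + (3 * t ^ 2 + 6 * δ ^ 2) := by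
  rw [← NNReal.coe_le_coe]
  push_cast
  nlinarith [sq_nonneg ((s : ℝ) - t), sq_nonneg ((s : ℝ) - 2 * δ), sq_nonneg ((t : ℝ) - 2 * δ)]

theorem three_mul_add_sq_le (s δ : ℝ≥0) :
    3 * (s + δ) ^ 2 + 6 * δ ^ 2 ≤ 6 * s ^ 2 + 12 * δ ^ 2 := by
  rw [← NNReal.coe_le_coe]
  push_cast
  nlinarith [sq_nonneg ((s : ℝ) - δ)]

/-- Measurable selection of nearly optimal couplings between two kernels with finite second
moments. -/
theorem exists_kernel_coupling_cost_le {Ω : Type*} [MeasurableSpace Ω] {E : Type}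
    [NormedAddCommGroup E] [MeasurableSpace E] [BorelSpace E] [SecondCountableTopology E]
    (κ η : Kernel Ω E) [IsMarkovKernel κ] [IsMarkovKernel η]
    (hκ : ∀ v, ∫⁻ x, (‖x‖₊ : ℝ≥0∞) ^ 2 ∂(κ v) ≠ ⊤) (hη : ∀ v, ∫⁻ x, (‖x‖₊ : ℝ≥0∞) ^ 2 ∂(η v) ≠ ⊤)
    (hW : Measurable fun v => W2sq (κ v) (η v)) {δ : ℝ≥0} (hδ : 0 < δ) (hδ1 : δ ≤ 1) :
    ∃ π : Kernel Ω (E × E), ∀ v, (π v).map Prod.fst = κ v ∧ (π v).map Prod.snd = η v ∧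
      ∫⁻ p, (‖p.1 - p.2‖₊ : ℝ≥0∞) ^ 2 ∂(π v) ≤
        (1 + 4 * δ) * (W2sq (κ v) (η v) + δ) + 20 * δ + δ := by
  have hδ' : (0 : ℝ≥0∞) < δ := by exact_mod_cast hδ
  obtain ⟨c, x, hc, hx⟩ := exists_measurable_nat_approx (E := E) hδ
  let C : ℕ → ℕ → ℝ≥0∞ := fun i j => (((‖x i - x j‖₊ + 2 * δ) ^ 2 : ℝ≥0) : ℝ≥0∞)
  let α : ℕ → ℝ≥0∞ := fun i => ((3 * ‖x i‖₊ ^ 2 + 6 * δ ^ 2 : ℝ≥0) : ℝ≥0∞)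
  have hx' : ∀ y, ‖x (c y) - y‖₊ ≤ δ := fun y => by rw [← nnnorm_neg, neg_sub]; exact hx y
  have hC1 : ∀ z : E × E, (‖z.1 - z.2‖₊ : ℝ≥0∞) ^ 2 ≤ C (c z.1) (c z.2) := by
    intro z
    have : ‖z.1 - z.2‖₊ ≤ ‖x (c z.1) - x (c z.2)‖₊ + 2 * δ := by
      calc ‖z.1 - z.2‖₊ = ‖(z.1 - x (c z.1)) + (x (c z.1) - x (c z.2)) + (x (c z.2) - z.2)‖₊ := by
            congr 1; abel
        _ ≤ δ + ‖x (c z.1) - x (c z.2)‖₊ + δ :=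
            (nnnorm_add_le _ _).trans
              (add_le_add ((nnnorm_add_le _ _).trans (add_le_add (hx _) le_rfl)) (hx' _))
        _ = _ := by ring
    simp only [C]
    exact_mod_cast pow_le_pow_left' this 2
  have hC2 : ∀ z : E × E, C (c z.1) (c z.2) ≤
      (1 + 4 * δ) * (‖z.1 - z.2‖₊ : ℝ≥0∞) ^ 2 + 20 * δ := by
    intro z
    have : ‖x (c z.1) - x (c z.2)‖₊ + 2 * δ ≤ ‖z.1 - z.2‖₊ + 4 * δ := by
      calc ‖x (c z.1) - x (c z.2)‖₊ + 2 * δ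
          = ‖(x (c z.1) - z.1) + (z.1 - z.2) + (z.2 - x (c z.2))‖₊ + 2 * δ := by
            congr 2; abel
        _ ≤ δ + ‖z.1 - z.2‖₊ + δ + 2 * δ := by
            gcongr
            exact (nnnorm_add_le _ _).trans
              (add_le_add ((nnnorm_add_le _ _).trans (add_le_add (hx' _) le_rfl)) (hx _))
        _ = _ := by ring
    simp only [C]
    exact_mod_cast (pow_le_pow_left' this 2).trans (add_four_mul_sq_le hδ1)
  have hCα : ∀ i j, C i j ≤ α i + α j := by
    intro i j
    have : ‖x i - x j‖₊ + 2 * δ ≤ ‖x i‖₊ + ‖x j‖₊ + 2 * δ := by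
      gcongr
      exact nnnorm_sub_le _ _
    simp only [C, α]
    exact_mod_cast (pow_le_pow_left' this 2).trans (add_add_two_mul_sq_le _ _ _)
  have hα : ∀ y : E, α (c y) ≤ 6 * (‖y‖₊ : ℝ≥0∞) ^ 2 + 12 * δ ^ 2 := by
    intro y
    have : ‖x (c y)‖₊ ≤ ‖y‖₊ + δ := by
      calc ‖x (c y)‖₊ = ‖y + (x (c y) - y)‖₊ := by congr 1; abel
        _ ≤ ‖y‖₊ + δ := (nnnorm_add_le _ _).trans (by gcongr; exact hx' _)
    have h3 : 3 * ‖x (c y)‖₊ ^ 2 + 6 * δ ^ 2 ≤ 6 * ‖y‖₊ ^ 2 + 12 * δ ^ 2 :=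
      le_trans (by gcongr) (three_mul_add_sq_le _ _)
    simp only [α]
    exact_mod_cast h3
  have hαfin : ∀ μ : Measure E, IsProbabilityMeasure μ → ∫⁻ x, (‖x‖₊ : ℝ≥0∞) ^ 2 ∂μ ≠ ⊤ →
      ∑' i, α i * μ (c ⁻¹' {i}) ≠ ⊤ := by
    intro μ _ hμ
    rw [← lintegral_comp_nat μ hc]
    refine ((lintegral_mono hα).trans_lt ?_).ne
    rw [lintegral_add_right _ measurable_const, lintegral_const_mul' _ _ (by simp)]
    simp only [lintegral_const, measure_univ, mul_one]
    exact ENNReal.add_lt_top.2 ⟨ENNReal.mul_lt_top (by simp) hμ.lt_top,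
      ENNReal.mul_lt_top (by simp) (by simp)⟩
  obtain ⟨P, hPm, hP⟩ := exists_measurable_discrete_coupling (C := C) (α := α) (β := α)
    (a := fun v i => κ v (c ⁻¹' {i})) (b := fun v i => η v (c ⁻¹' {i}))
    (W := fun v => (1 + 4 * δ) * (W2sq (κ v) (η v) + δ) + 20 * δ)
    (fun i => κ.measurable_coe (hc (measurableSet_singleton _)))
    (fun i => η.measurable_coe (hc (measurableSet_singleton _)))
    (((hW.add_const _).const_mul _).add_const _)
    (fun v => by rw [tsum_measure_fiber _ hc, measure_univ])
    (fun v => by rw [tsum_measure_fiber _ hc, measure_univ]) hCα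
    (fun i => ENNReal.coe_ne_top) (fun i => ENNReal.coe_ne_top)
    (fun v => hαfin _ inferInstance (hκ v)) (fun v => hαfin _ inferInstance (hη v))
    (fun v => by
      obtain ⟨π, h1, h2, h3⟩ := W2sq_exists_coupling (κ v) (η v) hδ'
      obtain ⟨p, hp1, hp2, hp⟩ := discrete_coupling_of_coupling h1 h2 hc
      have hπ : π univ = 1 := by
        rw [← preimage_univ (f := Prod.fst), ← Measure.map_apply measurable_fst .univ, h1,
          measure_univ]
      refine ⟨p, hp1, hp2, ?_⟩
      rw [hp]
      refine (lintegral_mono hC2).trans ?_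
      rw [lintegral_add_right _ measurable_const, lintegral_const_mul' _ _ (by finiteness),
        lintegral_const, hπ, mul_one]
      gcongr) hδ'
  obtain ⟨π, hπ⟩ := exists_kernel_coupling_of_discrete κ η hc hPm (fun v => (hP v).1)
    (fun v => (hP v).2.1)
  exact ⟨π, fun v => ⟨(hπ v).1, (hπ v).2.1, (lintegral_mono hC1).trans
    (((hπ v).2.2 C).trans (hP v).2.2)⟩⟩

theorem map_bind_of_forall {Ω E F : Type*} [MeasurableSpace Ω] [MeasurableSpace E]
    [MeasurableSpace F] (m : Measure Ω) {π : Ω → Measure F} (hπ : Measurable π) {f : F → E}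
    (hf : Measurable f) {κ : Ω → Measure E} (hκ : Measurable κ) (h : ∀ v, (π v).map f = κ v) :
    (m.bind π).map f = m.bind κ := by
  ext B hB
  rw [Measure.map_apply hf hB, Measure.bind_apply (hf hB) hπ.aemeasurable,
    Measure.bind_apply hB hκ.aemeasurable]
  simp only [← h, Measure.map_apply hf hB]

/-- Convexity of the squared Wasserstein distance under mixtures. -/
theorem W2sq_bind_le_s2 {Ω : Type*} [MeasurableSpace Ω] {E : Type}
    [NormedAddCommGroup E] [MeasurableSpace E] [BorelSpace E] [SecondCountableTopology E]
    (m : Measure Ω) [IsProbabilityMeasure m]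
    (κ η : Kernel Ω E) [IsMarkovKernel κ] [IsMarkovKernel η]
    (hκ : ∀ v, ∫⁻ x, (‖x‖₊ : ℝ≥0∞) ^ 2 ∂(κ v) ≠ ⊤) (hη : ∀ v, ∫⁻ x, (‖x‖₊ : ℝ≥0∞) ^ 2 ∂(η v) ≠ ⊤)
    (hW : Measurable fun v => W2sq (κ v) (η v)) :
    W2sq (m.bind κ) (m.bind η) ≤ ∫⁻ v, W2sq (κ v) (η v) ∂m := by
  set R := ∫⁻ v, W2sq (κ v) (η v) ∂m with hR
  have hcost : Measurable fun p : E × E => (‖p.1 - p.2‖₊ : ℝ≥0∞) ^ 2 := by fun_prop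
  have key : ∀ δ : ℝ≥0, 0 < δ → δ ≤ 1 →
      W2sq (m.bind κ) (m.bind η) ≤ (1 + 4 * δ) * (R + δ) + 20 * δ + δ := by
    intro δ hδ hδ1
    obtain ⟨π, hπ⟩ := exists_kernel_coupling_cost_le κ η hκ hη hW hδ hδ1
    refine (iInf₂_le (m.bind π)
      ⟨map_bind_of_forall m π.measurable measurable_fst κ.measurable fun v => (hπ v).1,
        map_bind_of_forall m π.measurable measurable_snd η.measurable fun v => (hπ v).2.1⟩).trans ?_
    rw [Measure.lintegral_bind π.aemeasurable hcost.aemeasurable]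
    refine (lintegral_mono fun v => (hπ v).2.2).trans_eq ?_
    rw [lintegral_add_right _ measurable_const, lintegral_add_right _ measurable_const,
      lintegral_const_mul' _ _ (by finiteness), lintegral_add_right _ measurable_const]
    simp [hR]
  rcases eq_or_ne R ⊤ with h | h
  · rw [h]; exact le_top
  · have hlim : Tendsto (fun δ : ℝ≥0 => (1 + 4 * (δ : ℝ≥0∞)) * (R + δ) + 20 * δ + δ)
        (nhdsWithin 0 (Ioi 0)) (nhds R) := by
      clear_value R
      lift R to ℝ≥0 using h
      have hc : Continuous fun δ : ℝ≥0 => (1 + 4 * δ) * (R + δ) + 20 * δ + δ := by fun_prop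
      have := (ENNReal.continuous_coe.comp hc).tendsto 0
      simp only [Function.comp_def] at this
      push_cast at this
      simpa using this.mono_left nhdsWithin_le_nhds
    refine ge_of_tendsto hlim ?_
    filter_upwards [Ioc_mem_nhdsGT (zero_lt_one (α := ℝ≥0))] with δ hδ
    exact key δ hδ.1 hδ.2

/-- The kernel obtained from a family in `MemM` by clamping the parameter to `[0,1]`. -/
def clampKernel {d : ℕ} {μ : ℝ → Measure (Ed d)} (hμ : MemM d μ) : Kernel ℝ (Ed d) where
  toFun v := μ (max 0 (min 1 v))
  measurable' := (Measure.measurable_of_measurable_coe _ hμ.meas).comp (by fun_prop)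

theorem clamp_mem_Icc (v : ℝ) : max 0 (min 1 v) ∈ Set.Icc (0:ℝ) 1 :=
  ⟨le_max_left _ _, max_le zero_le_one (min_le_left _ _)⟩

theorem clamp_eq_self {v : ℝ} (hv : v ∈ Set.Icc (0:ℝ) 1) : max 0 (min 1 v) = v := by
  rw [min_eq_right hv.2, max_eq_right hv.1]

theorem clampKernel_apply {d : ℕ} {μ : ℝ → Measure (Ed d)} (hμ : MemM d μ) (v : ℝ) :
    clampKernel hμ v = μ (max 0 (min 1 v)) := rfl

instance {d : ℕ} {μ : ℝ → Measure (Ed d)} (hμ : MemM d μ) : IsMarkovKernel (clampKernel hμ) :=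
  ⟨fun v => hμ.prob _ (clamp_mem_Icc v)⟩

theorem clampKernel_moment {d : ℕ} {μ : ℝ → Measure (Ed d)} (hμ : MemM d μ) (v : ℝ) :
    ∫⁻ x, (‖x‖₊ : ℝ≥0∞) ^ 2 ∂(clampKernel hμ v) ≠ ⊤ :=
  ((le_iSup₂ (f := fun u (_ : u ∈ Set.Icc (0:ℝ) 1) => ∫⁻ x, (‖x‖₊ : ℝ≥0∞) ^ 2 ∂(μ u)) _
    (clamp_mem_Icc v)).trans_lt hμ.moment).ne

/-- The normalised weight measure `‖G(u,·)‖₁⁻¹ G(u,v) dv` on `[0,1]`. -/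
def graphonWeight (G : ℝ → ℝ → ℝ) (u : ℝ) : Measure ℝ :=
  (volume.restrict (Set.Icc (0:ℝ) 1)).withDensity
    fun v => ENNReal.ofReal (G u v) / ENNReal.ofReal (deg G u)

theorem lintegral_graphonWeight {G : ℝ → ℝ → ℝ} (hG : IsGraphon G) (u : ℝ) {f : ℝ → ℝ≥0∞}
    (hf : Measurable f) :
    ∫⁻ v, f v ∂(graphonWeight G u) =
      (ENNReal.ofReal (deg G u))⁻¹ * ∫⁻ v in Set.Icc (0:ℝ) 1, ENNReal.ofReal (G u v) * f v := by
  have hm : Measurable fun v => ENNReal.ofReal (G u v) :=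
    (hG.measurable.comp measurable_prodMk_left).ennreal_ofReal
  rw [graphonWeight, lintegral_withDensity_eq_lintegral_mul _ (hm.div_const _) hf,
    ← lintegral_const_mul _ (by fun_prop)]
  refine lintegral_congr fun v => ?_
  simp only [Pi.mul_apply, div_eq_mul_inv]
  ring

theorem isProbabilityMeasure_graphonWeight {G : ℝ → ℝ → ℝ} (hG : IsGraphon G) {u : ℝ}
    (hu : u ∈ Set.Icc (0:ℝ) 1) (hdeg : 0 < deg G u) :
    IsProbabilityMeasure (graphonWeight G u) := by
  have hm : Measurable (G u) := hG.measurable.comp measurable_prodMk_left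
  have hnn : 0 ≤ᵐ[volume.restrict (Set.Icc (0:ℝ) 1)] G u :=
    (ae_restrict_iff' measurableSet_Icc).2 (ae_of_all _ fun v hv => (hG.mem_Icc u hu v hv).1)
  have hint : Integrable (G u) (volume.restrict (Set.Icc (0:ℝ) 1)) :=
    not_imp_comm.1 integral_undef hdeg.ne'
  refine ⟨?_⟩
  rw [← lintegral_one, lintegral_graphonWeight hG u measurable_const]
  simp only [mul_one]
  rw [← ofReal_integral_eq_lintegral_ofReal hint hnn]
  exact ENNReal.inv_mul_cancel (by simpa using hdeg) ENNReal.ofReal_ne_top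

theorem ae_graphonWeight_mem_Icc (G : ℝ → ℝ → ℝ) (u : ℝ) :
    ∀ᵐ v ∂(graphonWeight G u), v ∈ Set.Icc (0:ℝ) 1 :=
  (withDensity_absolutelyContinuous _ _).ae_le (ae_restrict_mem measurableSet_Icc)

theorem graphonAvg_eq_bind_clampKernel {d : ℕ} (G : ℝ → ℝ → ℝ) (u : ℝ)
    {μ : ℝ → Measure (Ed d)} (hμ : MemM d μ) :
    graphonAvg G μ u = (graphonWeight G u).bind (clampKernel hμ) := by
  refine Measure.bind_congr_right ?_
  filter_upwards [ae_graphonWeight_mem_Icc G u] with v hv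
  rw [clampKernel_apply, clamp_eq_self hv]

/-- the squared Wasserstein distance between graphon-averaged measures is
dominated by the graphon average of the squared Wasserstein distances. -/
theorem stmt_2 {d : ℕ} (G : ℝ → ℝ → ℝ) (hG : IsGraphon G)
    (u : ℝ) (hu : u ∈ Set.Icc (0:ℝ) 1) (hdeg : 0 < deg G u)
    (ν η : ℝ → Measure (Ed d)) (hν : MemM d ν) (hη : MemM d η)
    (hmeas : Measurable fun v => W2sq (ν v) (η v)) :
    W2sq (graphonAvg G ν u) (graphonAvg G η u) ≤
      (ENNReal.ofReal (deg G u))⁻¹ *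
        ∫⁻ v in Set.Icc (0:ℝ) 1, ENNReal.ofReal (G u v) * W2sq (ν v) (η v) := by
  have := isProbabilityMeasure_graphonWeight hG hu hdeg
  rw [← lintegral_graphonWeight hG u hmeas, graphonAvg_eq_bind_clampKernel G u hν,
    graphonAvg_eq_bind_clampKernel G u hη]
  refine (W2sq_bind_le_s2 _ _ _ (clampKernel_moment hν) (clampKernel_moment hη)
    (hmeas.comp (g := fun v => W2sq (ν v) (η v)) (by fun_prop : Measurable fun v : ℝ =>
      max 0 (min 1 v)))).trans_eq (lintegral_congr_ae ?_)
  filter_upwards [ae_graphonWeight_mem_Icc G u] with v hv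
  rw [clampKernel_apply, clampKernel_apply, clamp_eq_self hv]

end
end
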